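/- There are exactly five isomorphism classes of finite simple graphs (S,E) with |S| + |E| = 6; consequently, there are exactly five pairwise non-isomorphic Lie algebras over k of dimension six of the form n(S,E) associated with finite simple graphs. -/

import Mathlib

open ExteriorAlgebra

variable (k : Type*) [Field k]

section Wedge

variable {M : Type*} [AddCommGroup M] [Module k M]

/-- The wedge `v ∧ w` of two vectors, as an element of the second exterior power `⋀[k]^2 M`. -/
def wedge (v w : M) : ⋀[k]^2 M :=
  ⟨ι k v * ι k w, by
    show _ ∈ (LinearMap.range (ι k : M →ₗ[k] ExteriorAlgebra k M)) ^ 2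
    rw [pow_two]
    exact Submodule.mul_mem_mul (LinearMap.mem_range_self _ v) (LinearMap.mem_range_self _ w)⟩

theorem wedge_add_left (v v' w : M) :
    wedge k (v + v') w = wedge k v w + wedge k v' w :=
  Subtype.ext <| by simp [wedge, add_mul]

theorem wedge_add_right (v w w' : M) :
    wedge k v (w + w') = wedge k v w + wedge k v w' :=
  Subtype.ext <| by simp [wedge, mul_add]

theorem wedge_smul_left (t : k) (v w : M) :
    wedge k (t • v) w = t • wedge k v w :=
  Subtype.ext <| by simp [wedge, smul_mul_assoc]

theorem wedge_smul_right (t : k) (v w : M) :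
    wedge k v (t • w) = t • wedge k v w :=
  Subtype.ext <| by simp [wedge, mul_smul_comm]

theorem wedge_self (v : M) : wedge k v v = 0 :=
  Subtype.ext <| ι_sq_zero v

theorem wedge_zero_left (w : M) : wedge k 0 w = 0 :=
  Subtype.ext <| by simp [wedge]

theorem wedge_zero_right (v : M) : wedge k v 0 = 0 :=
  Subtype.ext <| by simp [wedge]

end Wedge

section Graph

variable (S : Type*) [DecidableEq S]

/-- The subspace `W ⊆ ⋀²V` spanned by the wedges `α ∧ β` of distinct non-adjacent vertices,
where `V = S → k` has standard basis indexed by the vertex set `S`. -/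
def graphW (G : SimpleGraph S) : Submodule k (⋀[k]^2 (S → k)) :=
  Submodule.span k
    {x | ∃ α β : S, α ≠ β ∧ ¬ G.Adj α β ∧
      x = wedge k (Pi.single α (1 : k)) (Pi.single β (1 : k))}

/-- The underlying vector space `V ⊕ (⋀²V)/W` of the two-step nilpotent Lie algebra `n(S,E)`
associated with a finite simple graph. -/
abbrev graphLie (G : SimpleGraph S) :=
  (S → k) × ((⋀[k]^2 (S → k)) ⧸ graphW k S G)

variable {S}
variable (G : SimpleGraph S)

instance : LieRing (graphLie k S G) where
  bracket p q := (0, Submodule.Quotient.mk (wedge k p.1 q.1))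
  add_lie p q r := by
    refine Prod.ext (by simp) ?_
    show Submodule.Quotient.mk (wedge k (p.1 + q.1) r.1) = _
    rw [wedge_add_left, Submodule.Quotient.mk_add]
    rfl
  lie_add p q r := by
    refine Prod.ext (by simp) ?_
    show Submodule.Quotient.mk (wedge k p.1 (q.1 + r.1)) = _
    rw [wedge_add_right, Submodule.Quotient.mk_add]
    rfl
  lie_self p := by
    refine Prod.ext rfl ?_
    show Submodule.Quotient.mk (wedge k p.1 p.1) = 0
    rw [wedge_self, Submodule.Quotient.mk_zero]
  leibniz_lie p q r := by
    refine Prod.ext (by simp) ?_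
    show Submodule.Quotient.mk (wedge k p.1 (0 : S → k)) =
      Submodule.Quotient.mk (wedge k (0 : S → k) r.1) +
        Submodule.Quotient.mk (wedge k q.1 (0 : S → k))
    simp [wedge_zero_left, wedge_zero_right]

instance : LieAlgebra k (graphLie k S G) where
  lie_smul t p q := by
    refine Prod.ext (show (0 : S → k) = t • 0 by simp) ?_
    show Submodule.Quotient.mk (wedge k p.1 (t • q.1)) = _
    rw [wedge_smul_right, Submodule.Quotient.mk_smul]
    rfl

theorem graphLie_bracket (p q : graphLie k S G) :
    ⁅p, q⁆ = (0, Submodule.Quotient.mk (wedge k p.1 q.1)) := rfl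

section ExteriorSquare

variable {M N : Type*} [AddCommGroup M] [Module k M] [AddCommGroup N] [Module k N]

theorem ιMulti_eq_wedge (a : Fin 2 → M) : exteriorPower.ιMulti k 2 a = wedge k (a 0) (a 1) :=
  Subtype.ext <| by simp [wedge, ExteriorAlgebra.ιMulti_apply, Matrix.vecTail]

theorem wedge_eq_ιMulti (v w : M) : wedge k v w = exteriorPower.ιMulti k 2 ![v, w] := by
  simp [ιMulti_eq_wedge]

theorem wedge_swap (v w : M) : wedge k w v = -wedge k v w := by
  have h := wedge_self k (v + w)
  rw [wedge_add_left, wedge_add_right, wedge_add_right, wedge_self, wedge_self, zero_add,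
    add_zero] at h
  exact (neg_eq_of_add_eq_zero_right h).symm

/-- The wedge product as a bilinear map. -/
def wedgeBilin : M →ₗ[k] M →ₗ[k] ⋀[k]^2 M :=
  LinearMap.mk₂ k (wedge k) (wedge_add_left k) (wedge_smul_left k) (wedge_add_right k)
    (wedge_smul_right k)

theorem map_wedge (f : M →ₗ[k] N) (v w : M) :
    exteriorPower.map 2 f (wedge k v w) = wedge k (f v) (f w) := by
  rw [wedge_eq_ιMulti, exteriorPower.map_apply_ιMulti, ιMulti_eq_wedge]
  rfl

variable {k}

theorem exteriorSquare_hom_ext {f g : ⋀[k]^2 M →ₗ[k] N}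
    (h : ∀ v w, f (wedge k v w) = g (wedge k v w)) : f = g := by
  refine exteriorPower.linearMap_ext (AlternatingMap.ext fun a => ?_)
  simpa [ιMulti_eq_wedge] using h (a 0) (a 1)

theorem exteriorSquare_pi_hom_ext {S : Type*} [Finite S] [DecidableEq S]
    {f g : ⋀[k]^2 (S → k) →ₗ[k] N}
    (h : ∀ i j, f (wedge k (Pi.single i 1) (Pi.single j 1)) =
      g (wedge k (Pi.single i 1) (Pi.single j 1))) : f = g := by
  refine exteriorSquare_hom_ext fun v w => ?_
  have : (wedgeBilin k).compr₂ f = (wedgeBilin k).compr₂ g := by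
    ext i j
    exact h i j
  exact LinearMap.congr_fun₂ this v w

variable (k)

/-- The linear form on `⋀²(S → k)` sending `v ∧ w` to `v i * w j - v j * w i`. -/
noncomputable def minor {S : Type*} (i j : S) : ⋀[k]^2 (S → k) →ₗ[k] k :=
  exteriorPower.alternatingMapLinearEquiv
    ((Matrix.detRowAlternating (n := Fin 2) (R := k)).compLinearMap (LinearMap.funLeft k k ![i, j]))

theorem minor_wedge {S : Type*} (i j : S) (v w : S → k) :
    minor k i j (wedge k v w) = v i * w j - v j * w i := by
  rw [minor, wedge_eq_ιMulti, exteriorPower.alternatingMapLinearEquiv_apply_ιMulti]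
  refine (Matrix.det_fin_two _).trans ?_
  simp [LinearMap.funLeft]

end ExteriorSquare

section Graph

variable {S : Type*} [DecidableEq S] (G : SimpleGraph S)

theorem minor_eq_zero_of_mem_graphW {i j : S} (hij : G.Adj i j) {x : ⋀[k]^2 (S → k)}
    (hx : x ∈ graphW k S G) : minor k i j x = 0 := by
  suffices graphW k S G ≤ LinearMap.ker (minor k i j) from this hx
  refine Submodule.span_le.2 ?_
  rintro _ ⟨α, β, -, hαβ, rfl⟩
  have h : ¬ (i = α ∧ j = β) := fun h => hαβ (h.1 ▸ h.2 ▸ hij)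
  have h' : ¬ (j = α ∧ i = β) := fun h => hαβ (h.1 ▸ h.2 ▸ hij.symm)
  simp only [SetLike.mem_coe, LinearMap.mem_ker, minor_wedge, Pi.single_apply]
  grind

variable {k G} in
theorem mk_wedge_single_eq_zero {i j : S} (h : ¬ G.Adj i j) :
    (graphW k S G).mkQ (wedge k (Pi.single i 1) (Pi.single j 1)) = 0 := by
  rcases eq_or_ne i j with rfl | hij
  · rw [wedge_self, map_zero]
  · exact (Submodule.Quotient.mk_eq_zero _).2 (Submodule.subset_span ⟨i, j, hij, h, rfl⟩)

omit [DecidableEq S] in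
theorem adj_out (e : G.edgeSet) : G.Adj e.1.out.1 e.1.out.2 := by
  rw [← SimpleGraph.mem_edgeSet, Sym2.mk, e.1.out_eq]
  exact e.2

/-- The coordinates of an element of `(⋀²V)/W` with respect to the edges, each edge being oriented
by a choice of representative. -/
noncomputable def edgeCoord : ((⋀[k]^2 (S → k)) ⧸ graphW k S G) →ₗ[k] (G.edgeSet → k) :=
  (graphW k S G).liftQ (LinearMap.pi fun e => minor k e.1.out.1 e.1.out.2) fun x hx => by
    exact LinearMap.mem_ker.2 (funext fun e => minor_eq_zero_of_mem_graphW k G (adj_out G e) hx)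

/-- The element of `(⋀²V)/W` with given coordinates with respect to the edges. -/
noncomputable def edgeSum [Fintype G.edgeSet] :
    (G.edgeSet → k) →ₗ[k] ((⋀[k]^2 (S → k)) ⧸ graphW k S G) :=
  Fintype.linearCombination k fun e : G.edgeSet =>
    (graphW k S G).mkQ (wedge k (Pi.single e.1.out.1 1) (Pi.single e.1.out.2 1))

theorem edgeCoord_mkQ_wedge (v w : S → k) (e : G.edgeSet) :
    edgeCoord k G ((graphW k S G).mkQ (wedge k v w)) e =
      v e.1.out.1 * w e.1.out.2 - v e.1.out.2 * w e.1.out.1 :=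
  minor_wedge k _ _ v w

theorem edgeSum_single [Fintype G.edgeSet] (e : G.edgeSet) :
    edgeSum k G (Pi.single e 1) =
      (graphW k S G).mkQ (wedge k (Pi.single e.1.out.1 1) (Pi.single e.1.out.2 1)) := by
  simp [edgeSum, Fintype.linearCombination_apply_single]

theorem edgeCoord_comp_edgeSum [Fintype G.edgeSet] :
    edgeCoord k G ∘ₗ edgeSum k G = LinearMap.id := by
  refine LinearMap.pi_ext' fun e => LinearMap.ext_ring (funext fun e' => ?_)
  simp only [LinearMap.comp_apply, LinearMap.coe_single, edgeSum_single, edgeCoord_mkQ_wedge,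
    LinearMap.id_apply]
  have h := (adj_out G e).ne
  have h' := (adj_out G e').ne
  have he : e = e' ↔ s(e.1.out.1, e.1.out.2) = s(e'.1.out.1, e'.1.out.2) := by
    rw [Sym2.mk, e.1.out_eq, Sym2.mk, e'.1.out_eq, Subtype.ext_iff]
  by_cases hee : e = e'
  · subst hee
    simp [h, h.symm]
  · rw [Pi.single_eq_of_ne' hee]
    rw [he, Sym2.eq_iff] at hee
    simp only [Pi.single_apply]
    grind

theorem edgeSum_comp_edgeCoord [Finite S] [Fintype G.edgeSet] :
    edgeSum k G ∘ₗ edgeCoord k G = LinearMap.id := by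
  refine Submodule.linearMap_qext _ (exteriorSquare_pi_hom_ext fun i j => ?_)
  simp only [LinearMap.comp_apply, LinearMap.id_apply]
  by_cases hij : G.Adj i j
  · set e : G.edgeSet := ⟨s(i, j), hij⟩
    obtain ⟨c, hc⟩ : ∃ c : k, (graphW k S G).mkQ (wedge k (Pi.single i 1) (Pi.single j 1)) =
        edgeSum k G (c • Pi.single e 1) := by
      have he : s(e.1.out.1, e.1.out.2) = s(i, j) := by rw [Sym2.mk, e.1.out_eq]
      rcases Sym2.eq_iff.1 he with ⟨h₁, h₂⟩ | ⟨h₁, h₂⟩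
      · exact ⟨1, by rw [one_smul, edgeSum_single, h₁, h₂]⟩
      · exact ⟨-1, by rw [map_smul, edgeSum_single, h₁, h₂, wedge_swap, map_neg, neg_one_smul]⟩
    rw [hc]
    exact congr_arg (edgeSum k G) (LinearMap.congr_fun (edgeCoord_comp_edgeSum k G) _)
  · rw [mk_wedge_single_eq_zero hij, map_zero, map_zero]

/-- The space `(⋀²V)/W` has a basis indexed by the edges. -/
noncomputable def edgeEquiv [Finite S] [Fintype G.edgeSet] :
    ((⋀[k]^2 (S → k)) ⧸ graphW k S G) ≃ₗ[k] (G.edgeSet → k) :=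
  LinearEquiv.ofLinearMap (edgeCoord k G) (edgeSum k G) (edgeCoord_comp_edgeSum k G)
    (edgeSum_comp_edgeCoord k G)

instance [Finite S] : Module.Finite k ((⋀[k]^2 (S → k)) ⧸ graphW k S G) := by
  have := Fintype.ofFinite G.edgeSet
  exact Module.Finite.equiv (edgeEquiv k G).symm

theorem finrank_graphW_quotient [Finite S] :
    Module.finrank k ((⋀[k]^2 (S → k)) ⧸ graphW k S G) = Nat.card G.edgeSet := by
  have := Fintype.ofFinite G.edgeSet
  rw [(edgeEquiv k G).finrank_eq, Module.finrank_fintype_fun_eq_card, Nat.card_eq_fintype_card]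

theorem finrank_graphLie [Fintype S] :
    Module.finrank k (graphLie k S G) = Fintype.card S + Nat.card G.edgeSet := by
  rw [Module.finrank_prod, finrank_graphW_quotient, Module.finrank_fintype_fun_eq_card]

end Graph

section BracketSpan

variable {L L' : Type*} [LieRing L] [LieAlgebra k L] [LieRing L'] [LieAlgebra k L']

variable (L) in
/-- The subspace of a Lie algebra spanned by all brackets. -/
def bracketSpan : Submodule k L :=
  Submodule.span k {z | ∃ x y : L, ⁅x, y⁆ = z}

variable {k}

theorem map_bracketSpan (f : L ≃ₗ⁅k⁆ L') :
    (bracketSpan k L).map (f.toLinearEquiv : L →ₗ[k] L') = bracketSpan k L' := by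
  rw [bracketSpan, bracketSpan, Submodule.map_span]
  congr 1
  ext z
  constructor
  · rintro ⟨_, ⟨x, y, rfl⟩, rfl⟩
    exact ⟨f x, f y, (f.map_lie x y).symm⟩
  · rintro ⟨x, y, rfl⟩
    refine ⟨_, ⟨f.symm x, f.symm y, rfl⟩, ?_⟩
    change f ⁅f.symm x, f.symm y⁆ = _
    rw [LieEquiv.map_lie, f.apply_symm_apply, f.apply_symm_apply]

theorem finrank_bracketSpan_congr (f : L ≃ₗ⁅k⁆ L') :
    Module.finrank k (bracketSpan k L) = Module.finrank k (bracketSpan k L') := by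
  rw [← map_bracketSpan f]
  exact (LinearEquiv.finrank_map_eq f.toLinearEquiv _).symm

theorem mem_bracketSpan_iff (f : L ≃ₗ⁅k⁆ L') (z : L) :
    f z ∈ bracketSpan k L' ↔ z ∈ bracketSpan k L := by
  rw [← map_bracketSpan f]
  exact (f.toLinearEquiv.injective.mem_set_image (s := bracketSpan k L))

end BracketSpan

section GraphLie

variable {S T : Type*} [DecidableEq S] [DecidableEq T] {G : SimpleGraph S} {H : SimpleGraph T}

variable (G) in
theorem bracketSpan_graphLie :
    bracketSpan k (graphLie k S G) = LinearMap.ker (LinearMap.fst k (S → k) _) := by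
  refine le_antisymm (Submodule.span_le.2 ?_) ?_
  · rintro _ ⟨x, y, rfl⟩
    rfl
  · rw [LinearMap.ker_fst, ← Submodule.map_top, Submodule.map_le_iff_le_comap,
      ← Submodule.range_mkQ, LinearMap.range_le_iff_comap, ← top_le_iff,
      ← exteriorPower.ιMulti_span, Submodule.span_le]
    rintro _ ⟨a, rfl⟩
    rw [ιMulti_eq_wedge]
    exact Submodule.subset_span ⟨(a 0, 0), (a 1, 0), rfl⟩

variable {k}

theorem mem_bracketSpan_graphLie {p : graphLie k S G} :
    p ∈ bracketSpan k (graphLie k S G) ↔ p.1 = 0 := by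
  rw [bracketSpan_graphLie]
  rfl

theorem finrank_bracketSpan_graphLie [Finite S] :
    Module.finrank k (bracketSpan k (graphLie k S G)) = Nat.card G.edgeSet := by
  rw [bracketSpan_graphLie, LinearMap.ker_fst,
    LinearMap.finrank_range_of_inj LinearMap.inr_injective, finrank_graphW_quotient]

theorem card_edgeSet_eq_of_lieEquiv [Finite S] [Finite T]
    (f : graphLie k S G ≃ₗ⁅k⁆ graphLie k T H) : Nat.card G.edgeSet = Nat.card H.edgeSet := by
  rw [← finrank_bracketSpan_graphLie (k := k), finrank_bracketSpan_congr f,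
    finrank_bracketSpan_graphLie]

/-- A graph has an isolated vertex if and only if its Lie algebra has a central element that is
not a combination of brackets. -/
theorem exists_isolated_iff [Finite S] :
    (∃ i, ∀ j, ¬ G.Adj i j) ↔
      ∃ p : graphLie k S G, (∀ q : graphLie k S G, ⁅p, q⁆ = 0) ∧
        p ∉ bracketSpan k (graphLie k S G) := by
  constructor
  · rintro ⟨i, hi⟩
    refine ⟨(Pi.single i 1, 0), fun q => Prod.ext rfl ?_, ?_⟩
    · have : (graphW k S G).mkQ ∘ₗ wedgeBilin k (Pi.single i 1) = 0 := by
        refine LinearMap.pi_ext' fun j => LinearMap.ext_ring ?_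
        exact mk_wedge_single_eq_zero (hi j)
      exact LinearMap.congr_fun this q.1
    · rw [mem_bracketSpan_graphLie]
      exact fun h => one_ne_zero (α := k) (by simpa using congr_fun h i)
  · rintro ⟨p, hp, hp'⟩
    by_contra! hG
    refine hp' (mem_bracketSpan_graphLie.2 (funext fun i => ?_))
    obtain ⟨j, hij⟩ := hG i
    have h : (graphW k S G).mkQ (wedge k p.1 (Pi.single j 1)) = 0 :=
      congr_arg Prod.snd (hp (Pi.single j 1, 0))
    have := minor_eq_zero_of_mem_graphW k G hij ((Submodule.Quotient.mk_eq_zero _).1 h)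
    simpa [minor_wedge, hij.ne] using this

theorem exists_isolated_of_lieEquiv [Finite S] [Finite T]
    (f : graphLie k S G ≃ₗ⁅k⁆ graphLie k T H) (h : ∃ i, ∀ j, ¬ G.Adj i j) :
    ∃ i, ∀ j, ¬ H.Adj i j := by
  obtain ⟨p, hp, hp'⟩ := (exists_isolated_iff (k := k)).1 h
  refine (exists_isolated_iff (k := k)).2 ⟨f p, fun q => ?_, fun h => hp' ?_⟩
  · rw [← f.apply_symm_apply q, ← LieEquiv.map_lie, hp]
    exact map_zero f.toLinearEquiv
  · exact (mem_bracketSpan_iff f p).1 h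

variable (k)

/-- The linear equivalence of exterior squares induced by a bijection of bases. -/
noncomputable def exteriorSquareCongr (e : S ≃ T) :
    ⋀[k]^2 (S → k) ≃ₗ[k] ⋀[k]^2 (T → k) :=
  LinearEquiv.ofLinearMap (exteriorPower.map 2 (LinearEquiv.funCongrLeft k k e.symm).toLinearMap)
    (exteriorPower.map 2 (LinearEquiv.funCongrLeft k k e).toLinearMap)
    (by
      rw [← exteriorPower.map_comp, ← exteriorPower.map_id]
      congr 1
      ext; simp)
    (by
      rw [← exteriorPower.map_comp, ← exteriorPower.map_id]
      congr 1
      ext; simp)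

omit [DecidableEq S] [DecidableEq T] in
theorem exteriorSquareCongr_wedge (e : S ≃ T) (v w : S → k) :
    exteriorSquareCongr k e (wedge k v w) = wedge k (v ∘ e.symm) (w ∘ e.symm) :=
  map_wedge k _ v w

theorem map_graphW_le (e : G ≃g H) :
    (graphW k S G).map (exteriorSquareCongr k e.toEquiv).toLinearMap ≤ graphW k T H := by
  rw [graphW, Submodule.map_span, Submodule.span_le]
  rintro _ ⟨_, ⟨i, j, hij, h, rfl⟩, rfl⟩
  refine Submodule.subset_span ⟨e i, e j, e.injective.ne hij, by rwa [e.map_adj_iff], ?_⟩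
  refine (exteriorSquareCongr_wedge k _ _ _).trans ?_
  congr 1 <;>
  · ext t
    simp [Pi.single_apply, Equiv.symm_apply_eq]

theorem map_graphW (e : G ≃g H) :
    (graphW k S G).map (exteriorSquareCongr k e.toEquiv).toLinearMap = graphW k T H := by
  refine le_antisymm (map_graphW_le k e) fun x hx => ?_
  exact ⟨_, map_graphW_le k e.symm (Submodule.mem_map_of_mem hx),
    (exteriorSquareCongr k e.toEquiv).apply_symm_apply x⟩

/-- Isomorphic graphs have isomorphic Lie algebras. -/
noncomputable def graphLieCongr (e : G ≃g H) : graphLie k S G ≃ₗ⁅k⁆ graphLie k T H where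
  __ := (LinearEquiv.funCongrLeft k k e.toEquiv.symm).prodCongr
    (Submodule.Quotient.equiv _ _ (exteriorSquareCongr k e.toEquiv) (map_graphW k e))
  map_lie' {x y} := by
    refine Prod.ext (map_zero (LinearEquiv.funCongrLeft k k e.toEquiv.symm)) ?_
    exact congr_arg (Submodule.Quotient.mk (p := graphW k T H)) (exteriorSquareCongr_wedge k _ _ _)

end GraphLie

section Classification

theorem exists_equiv_extend {S : Type*} [Fintype S] {n : ℕ} (hn : Fintype.card S = n)
    {s : Set (Fin n)} {f : Fin n → S} (hf : s.InjOn f) : ∃ g : Fin n ≃ S, ∀ i ∈ s, g i = f i := by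
  classical
  obtain ⟨g, hg⟩ := Set.MapsTo.exists_equiv_extend_of_card_eq (t := Finset.univ)
    (by simpa using hn.symm) (fun _ _ => Finset.mem_coe.2 (Finset.mem_univ (f _))) hf
  exact ⟨g.trans (Equiv.subtypeUnivEquiv Finset.mem_univ), hg⟩

/-- The five graphs for which the numbers of vertices and edges add up to six. -/
def sixGraphs : Fin 5 → Σ n, SimpleGraph (Fin n) :=
  ![⟨6, ⊥⟩, ⟨5, SimpleGraph.fromEdgeSet {s(0, 1)}⟩, ⟨4, SimpleGraph.fromEdgeSet {s(0, 1), s(1, 2)}⟩,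
    ⟨4, SimpleGraph.fromEdgeSet {s(0, 1), s(2, 3)}⟩, ⟨3, ⊤⟩]

theorem card_edgeSet_sixGraphs (i : Fin 5) :
    Nat.card (sixGraphs i).2.edgeSet = (![0, 1, 2, 2, 3] : Fin 5 → ℕ) i := by
  fin_cases i
  · show Nat.card (⊥ : SimpleGraph (Fin 6)).edgeSet = 0
    simp
  · show Nat.card (SimpleGraph.fromEdgeSet ({s(0, 1)} : Set (Sym2 (Fin 5)))).edgeSet = 1
    rw [SimpleGraph.edgeSet_fromEdgeSet, Nat.card_eq_fintype_card]
    decide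
  · show Nat.card (SimpleGraph.fromEdgeSet ({s(0, 1), s(1, 2)} : Set (Sym2 (Fin 4)))).edgeSet = 2
    rw [SimpleGraph.edgeSet_fromEdgeSet, Nat.card_eq_fintype_card]
    decide
  · show Nat.card (SimpleGraph.fromEdgeSet ({s(0, 1), s(2, 3)} : Set (Sym2 (Fin 4)))).edgeSet = 2
    rw [SimpleGraph.edgeSet_fromEdgeSet, Nat.card_eq_fintype_card]
    decide
  · show Nat.card (⊤ : SimpleGraph (Fin 3)).edgeSet = 3
    rw [Nat.card_eq_fintype_card]
    decide

theorem card_add_card_edgeSet_sixGraphs (i : Fin 5) :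
    (sixGraphs i).1 + Nat.card (sixGraphs i).2.edgeSet = 6 := by
  rw [card_edgeSet_sixGraphs]
  fin_cases i <;> rfl

theorem exists_isolated_sixGraphs_two : ∃ i, ∀ j, ¬ (sixGraphs 2).2.Adj i j := by
  refine ⟨(3 : Fin 4), ?_⟩
  show ∀ j : Fin 4, ¬ (SimpleGraph.fromEdgeSet {s(0, 1), s(1, 2)}).Adj 3 j
  simp only [SimpleGraph.fromEdgeSet_adj, Set.mem_insert_iff, Set.mem_singleton_iff]
  decide

theorem not_exists_isolated_sixGraphs_three : ¬ ∃ i, ∀ j, ¬ (sixGraphs 3).2.Adj i j := by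
  show ¬ ∃ i : Fin 4, ∀ j : Fin 4, ¬ (SimpleGraph.fromEdgeSet {s(0, 1), s(2, 3)}).Adj i j
  simp only [SimpleGraph.fromEdgeSet_adj, Set.mem_insert_iff, Set.mem_singleton_iff]
  decide

theorem isEmpty_lieEquiv_sixGraphs {i j : Fin 5} (hij : i ≠ j) :
    IsEmpty (graphLie k _ (sixGraphs i).2 ≃ₗ⁅k⁆ graphLie k _ (sixGraphs j).2) := by
  refine ⟨fun f => ?_⟩
  have h := card_edgeSet_eq_of_lieEquiv f
  rw [card_edgeSet_sixGraphs, card_edgeSet_sixGraphs] at h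
  obtain ⟨rfl, rfl⟩ | ⟨rfl, rfl⟩ : i = 2 ∧ j = 3 ∨ i = 3 ∧ j = 2 := by
    clear f
    revert i j
    decide
  · exact not_exists_isolated_sixGraphs_three
      (exists_isolated_of_lieEquiv f exists_isolated_sixGraphs_two)
  · exact not_exists_isolated_sixGraphs_three
      (exists_isolated_of_lieEquiv f.symm exists_isolated_sixGraphs_two)

variable {S : Type*} [Fintype S] {G : SimpleGraph S}

omit [Fintype S] in
theorem nonempty_iso_fromEdgeSet {n : ℕ} (g : Fin n ≃ S) {s : Set (Sym2 (Fin n))}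
    (h : G.edgeSet = Sym2.map g '' s) : Nonempty (G ≃g SimpleGraph.fromEdgeSet s) := by
  refine ⟨RelIso.symm ⟨g, fun {x y} => ?_⟩⟩
  have := (Sym2.map.injective g.injective).mem_set_image (s := s) (a := s(x, y))
  rw [← SimpleGraph.mem_edgeSet, h, SimpleGraph.fromEdgeSet_adj, ← this]
  refine ⟨fun hxy => ⟨hxy, ?_⟩, And.left⟩
  rintro rfl
  exact G.loopless.irrefl (g x) (by rw [← SimpleGraph.mem_edgeSet, h]; exact hxy)

theorem nonempty_iso_of_card_edgeSet_eq_one (hS : Fintype.card S = 5)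
    (hG : Nat.card G.edgeSet = 1) : Nonempty (G ≃g (sixGraphs 1).2) := by
  obtain ⟨e, he⟩ := Set.ncard_eq_one.1 hG
  induction e with | _ a b
  have hab : a ≠ b := G.ne_of_adj (show s(a, b) ∈ G.edgeSet by simp [he])
  obtain ⟨g, hg⟩ := exists_equiv_extend hS (s := {0, 1}) (f := ![a, b, a, a, a]) (by
    simp [Set.InjOn, hab, hab.symm])
  have h₀ : g 0 = a := hg 0 (by simp)
  have h₁ : g 1 = b := hg 1 (by simp)
  exact nonempty_iso_fromEdgeSet g (by simp [he, h₀, h₁])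

theorem nonempty_iso_of_incident (hS : Fintype.card S = 4) {a b c : S} (hac : a ≠ c)
    (hG : G.edgeSet = {s(a, b), s(b, c)}) : Nonempty (G ≃g (sixGraphs 2).2) := by
  have hab : a ≠ b := G.ne_of_adj (show s(a, b) ∈ G.edgeSet by simp [hG])
  have hbc : b ≠ c := G.ne_of_adj (show s(b, c) ∈ G.edgeSet by simp [hG])
  obtain ⟨g, hg⟩ := exists_equiv_extend hS (s := {0, 1, 2}) (f := ![a, b, c, a]) (by
    simp [Set.InjOn, hab, hab.symm, hac, hac.symm, hbc, hbc.symm])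
  have h₀ : g 0 = a := hg 0 (by simp)
  have h₁ : g 1 = b := hg 1 (by simp)
  have h₂ : g 2 = c := hg 2 (by simp)
  exact nonempty_iso_fromEdgeSet g (by simp [hG, Set.image_insert_eq, h₀, h₁, h₂])

theorem nonempty_iso_of_card_edgeSet_eq_two (hS : Fintype.card S = 4)
    (hG : Nat.card G.edgeSet = 2) : ∃ i, Nonempty (G ≃g (sixGraphs i).2) := by
  obtain ⟨e, e', hne, he⟩ := Set.ncard_eq_two.1 hG
  induction e with | _ a b
  induction e' with | _ c d
  have hab : a ≠ b := G.ne_of_adj (show s(a, b) ∈ G.edgeSet by simp [he])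
  have hcd : c ≠ d := G.ne_of_adj (show s(c, d) ∈ G.edgeSet by simp [he])
  by_cases hbc : b = c
  · subst hbc
    exact ⟨2, nonempty_iso_of_incident hS (by rintro rfl; exact hne Sym2.eq_swap) he⟩
  by_cases hbd : b = d
  · subst hbd
    rw [Sym2.eq_swap (a := c)] at he
    exact ⟨2, nonempty_iso_of_incident hS (by rintro rfl; exact hne rfl) he⟩
  by_cases hac : a = c
  · subst hac
    rw [Sym2.eq_swap (a := a) (b := b)] at he
    exact ⟨2, nonempty_iso_of_incident hS hbd he⟩
  by_cases had : a = d
  · subst had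
    rw [Sym2.eq_swap (a := a) (b := b), Sym2.eq_swap (a := c)] at he
    exact ⟨2, nonempty_iso_of_incident hS hbc he⟩
  obtain ⟨g, hg⟩ := exists_equiv_extend hS (s := Set.univ) (f := ![a, b, c, d]) (by
    rw [Set.injOn_univ]
    intro i j
    fin_cases i <;> fin_cases j <;> simp [*, Ne.symm, eq_comm])
  have h₀ : g 0 = a := hg 0 (by simp)
  have h₁ : g 1 = b := hg 1 (by simp)
  have h₂ : g 2 = c := hg 2 (by simp)
  have h₃ : g 3 = d := hg 3 (by simp)
  exact ⟨3, nonempty_iso_fromEdgeSet g (by simp [he, Set.image_insert_eq, h₀, h₁, h₂, h₃])⟩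

theorem exists_iso_sixGraphs (h : Fintype.card S + Nat.card G.edgeSet = 6) :
    ∃ i, Nonempty (G ≃g (sixGraphs i).2) := by
  classical
  have hle := G.card_edgeFinset_le_card_choose_two
  rw [← SimpleGraph.card_edgeSet, ← Nat.card_eq_fintype_card] at hle
  generalize hm : Nat.card G.edgeSet = m at h hle
  generalize hn : Fintype.card S = n at h hle
  obtain rfl : m = 6 - n := by omega
  have hn6 : n ≤ 6 := by omega
  interval_cases n
  iterate 3 exact absurd hle (by decide)
  · refine ⟨4, ⟨?_⟩⟩
    have : G = ⊤ := by
      rw [← SimpleGraph.edgeFinset_inj]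
      refine Finset.eq_of_subset_of_card_le (SimpleGraph.edgeFinset_mono le_top) ?_
      rw [SimpleGraph.card_edgeFinset_top_eq_card_choose_two, hn, ← SimpleGraph.card_edgeSet,
        ← Nat.card_eq_fintype_card, hm]
      decide
    rw [this]
    exact SimpleGraph.Iso.completeGraph (Fintype.equivFinOfCardEq hn)
  · exact nonempty_iso_of_card_edgeSet_eq_two hn hm
  · exact ⟨1, nonempty_iso_of_card_edgeSet_eq_one hn hm⟩
  · refine ⟨0, ⟨?_⟩⟩
    have : G = ⊥ := by
      rw [← SimpleGraph.edgeSet_eq_empty, ← Set.ncard_eq_zero]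
      exact hm
    rw [this]
    exact ⟨Fintype.equivFinOfCardEq hn, Iff.rfl⟩

end Classification

end Graph

/-- There are exactly five isomorphism classes of finite simple graphs
`(S,E)` with `|S| + |E| = 6`; consequently there are exactly five pairwise non-isomorphic Lie
algebras over `k` of dimension six of the form `n(S,E)`. -/
theorem five_graphs_and_five_lie_algebras
    (hk : ringChar k ≠ 2) :
    ∃ (m : Fin 5 → ℕ) (Gs : ∀ i, SimpleGraph (Fin (m i))),
      (∀ i, m i + Nat.card (Gs i).edgeSet = 6) ∧
      (∀ i j, i ≠ j → IsEmpty (Gs i ≃g Gs j)) ∧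
      (∀ (S : Type) [Fintype S] [DecidableEq S] (G : SimpleGraph S),
        Fintype.card S + Nat.card G.edgeSet = 6 → ∃ i, Nonempty (G ≃g Gs i)) ∧
      (∀ i, Module.finrank k (graphLie k (Fin (m i)) (Gs i)) = 6) ∧
      (∀ i j, i ≠ j →
        IsEmpty (graphLie k (Fin (m i)) (Gs i) ≃ₗ⁅k⁆ graphLie k (Fin (m j)) (Gs j))) ∧
      (∀ (S : Type) [Fintype S] [DecidableEq S] (G : SimpleGraph S),
        Fintype.card S + Nat.card G.edgeSet = 6 →
          ∃ i, Nonempty (graphLie k S G ≃ₗ⁅k⁆ graphLie k (Fin (m i)) (Gs i))) := by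
  exact ⟨fun i => (sixGraphs i).1, fun i => (sixGraphs i).2, card_add_card_edgeSet_sixGraphs,
    fun i j hij => ⟨fun e => (isEmpty_lieEquiv_sixGraphs k hij).false (graphLieCongr k e)⟩,
    fun S _ _ G hG => exists_iso_sixGraphs hG,
    fun i => by
      rw [finrank_graphLie, Fintype.card_fin, card_add_card_edgeSet_sixGraphs],
    fun i j hij => isEmpty_lieEquiv_sixGraphs k hij,
    fun S _ _ G hG => (exists_iso_sixGraphs hG).imp fun i e => e.map (graphLieCongr k)⟩
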